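/- Let (p_j)_{j≥1} be regularly varying with index α ∈ (0,1). Then for every integer r ≥ 1, Φ_{n,r} := Σ_{j≥1} (n p_j)^r e^{−n p_j}/r! satisfies Φ_{n,r} ≃ (α Γ(r−α)/r!) · n^α ℓ(n) as n → ∞; in particular Φ_{n,r} → ∞. -/

import Mathlib

open Filter Topology

namespace PhiAux
open MeasureTheory

/-- Counting function. -/
noncomputable def cnt (p : ℕ → ℝ) (x : ℝ) : ℝ := (Nat.card {j | x ≤ p j} : ℝ)

lemma finite_set {p : ℕ → ℝ} (hsum : Summable p) {x : ℝ} (hx : 0 < x) :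
    {j | x ≤ p j}.Finite := by
  have h := hsum.tendsto_cofinite_zero.eventually (gt_mem_nhds hx)
  rw [Filter.eventually_cofinite] at h
  simpa using h

lemma cnt_anti {p : ℕ → ℝ} (hsum : Summable p) {x y : ℝ} (hx : 0 < x) (hxy : x ≤ y) :
    cnt p y ≤ cnt p x := by
  unfold cnt
  exact_mod_cast Nat.card_mono (finite_set hsum hx) (fun j (hj : y ≤ p j) => hxy.trans hj)

lemma cnt_nonneg (p : ℕ → ℝ) (x : ℝ) : 0 ≤ cnt p x := Nat.cast_nonneg _

lemma cnt_ratio {p : ℕ → ℝ} {α : ℝ} {L : ℝ → ℝ}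
    (hL : ∀ c : ℝ, 0 < c → Tendsto (fun t : ℝ => L (c * t) / L t) atTop (𝓝 1))
    (hreg : Tendsto (fun x : ℝ => cnt p x / (x ^ (-α) * L (1 / x))) (𝓝[>] (0 : ℝ)) (𝓝 1))
    {c : ℝ} (hc : 0 < c) :
    Tendsto (fun x => cnt p (c * x) / cnt p x) (𝓝[>] (0 : ℝ)) (𝓝 (c ^ (-α))) := by
  have hm : Tendsto (fun x : ℝ => c * x) (𝓝[>] (0 : ℝ)) (𝓝[>] (0 : ℝ)) := by
    refine tendsto_nhdsWithin_iff.2 ⟨?_, ?_⟩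
    · have : Tendsto (fun x : ℝ => c * x) (𝓝 0) (𝓝 (c * 0)) := tendsto_id.const_mul c
      rw [mul_zero] at this
      exact this.mono_left nhdsWithin_le_nhds
    · filter_upwards [self_mem_nhdsWithin] with x hx
      exact mul_pos hc hx
  have h1 := hreg.comp hm
  have h2 := (hL c⁻¹ (inv_pos.2 hc)).comp tendsto_inv_nhdsGT_zero
  have h3 := ((h1.div hreg one_ne_zero).mul h2).mul_const (c ^ (-α))
  simp only [div_one, one_mul] at h3
  refine h3.congr' ?_
  filter_upwards [h1.eventually_ne one_ne_zero, hreg.eventually_ne one_ne_zero,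
    self_mem_nhdsWithin] with x e1 e2 hx
  have hx : 0 < x := hx
  simp only [Function.comp, Pi.div_apply, Pi.mul_apply] at *
  have e3 : 1 / (c * x) = c⁻¹ * x⁻¹ := by field_simp
  have e4 : 1 / x = x⁻¹ := one_div x
  rw [e3, Real.mul_rpow hc.le hx.le] at e1
  rw [e4] at e2
  rw [e3, e4, Real.mul_rpow hc.le hx.le]
  have hca := (Real.rpow_pos_of_pos hc (-α)).ne'
  have hxa := (Real.rpow_pos_of_pos hx (-α)).ne'
  generalize L (c⁻¹ * x⁻¹) = l at *
  generalize L (x⁻¹) = m at *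
  have l1 : l ≠ 0 := by
    intro h; simp [h] at e1
  have l2 : m ≠ 0 := by
    intro h; simp [h] at e2
  have l3 : cnt p x ≠ 0 := by
    intro h; simp [h] at e2
  field_simp

lemma cnt_tendsto {p : ℕ → ℝ} (hsum : Summable p) {α : ℝ} (hα : 0 < α)
    (hr : Tendsto (fun x => cnt p ((1/2 : ℝ) * x) / cnt p x) (𝓝[>] (0 : ℝ))
      (𝓝 ((1/2 : ℝ) ^ (-α)))) :
    Tendsto (cnt p) (𝓝[>] (0 : ℝ)) atTop := by
  have h1 : (1:ℝ) < (1/2 : ℝ) ^ (-α) :=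
    Real.one_lt_rpow_of_pos_of_lt_one_of_neg (by norm_num) (by norm_num) (by linarith)
  have h := hr.eventually (lt_mem_nhds h1)
  rw [eventually_nhdsWithin_iff, Metric.eventually_nhds_iff] at h
  obtain ⟨ε, hε, h⟩ := h
  have step : ∀ x, 0 < x → x < ε → cnt p x + 1 ≤ cnt p ((1/2 : ℝ) * x) := by
    intro x hx hxe
    have := h (y := x) (by simpa [abs_of_pos hx] using hxe) hx
    have h0 : 0 < cnt p x := by
      rcases (cnt_nonneg p x).lt_or_eq with h' | h'
      · exact h'
      · rw [← h'] at this; simp at this; linarith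
    rw [lt_div_iff₀ h0, one_mul] at this
    unfold cnt at *
    exact_mod_cast this
  have it : ∀ k : ℕ, (k : ℝ) ≤ cnt p ((1/2 : ℝ) ^ k * (ε / 2)) := by
    intro k
    induction k with
    | zero => simpa using cnt_nonneg p _
    | succ k ih =>
      have h1 : (1/2 : ℝ) ^ k ≤ 1 := pow_le_one₀ (by norm_num) (by norm_num)
      have := step ((1/2 : ℝ) ^ k * (ε / 2)) (by positivity) (by nlinarith)
      rw [← mul_assoc, ← pow_succ'] at this
      push_cast; linarith
  refine tendsto_atTop.2 fun b => ?_
  obtain ⟨k, hk⟩ := exists_nat_ge b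
  have : Set.Ioo (0:ℝ) ((1/2 : ℝ) ^ k * (ε / 2)) ∈ 𝓝[>] (0:ℝ) :=
    Ioo_mem_nhdsGT (by positivity)
  filter_upwards [this] with x hx
  exact hk.trans ((it k).trans (cnt_anti hsum hx.1 hx.2.le))

/-- Potter-type bound. -/
lemma potter {p : ℕ → ℝ} (hsum : Summable p) {α β : ℝ} (hα : 0 < α) (hβ : α < β)
    (hr : Tendsto (fun x => cnt p ((1/2 : ℝ) * x) / cnt p x) (𝓝[>] (0 : ℝ))
      (𝓝 ((1/2 : ℝ) ^ (-α)))) :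
    ∀ᶠ x in 𝓝[>] (0 : ℝ), 0 < cnt p x ∧ ∀ s, 0 < s → s ≤ 1 →
      cnt p (s * x) ≤ 2 ^ β * s ^ (-β) * cnt p x := by
  have h1 : (1/2 : ℝ) ^ (-α) < (1/2 : ℝ) ^ (-β) :=
    Real.rpow_lt_rpow_of_exponent_gt (by norm_num) (by norm_num) (by linarith)
  have h2 : (1/2 : ℝ) ^ (-β) = 2 ^ β := by
    rw [one_div, Real.inv_rpow (by norm_num), Real.rpow_neg (by norm_num), inv_inv]
  rw [h2] at h1
  have h := (hr.eventually (gt_mem_nhds h1)).and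
    ((cnt_tendsto hsum hα hr).eventually (eventually_gt_atTop 0))
  rw [eventually_nhdsWithin_iff, Metric.eventually_nhds_iff] at h
  obtain ⟨ε, hε, h⟩ := h
  have hB : (0:ℝ) < 2 ^ β := by positivity
  filter_upwards [Ioo_mem_nhdsGT hε] with x hx
  have hx0 := hx.1
  have hxe := hx.2
  have H : ∀ y, 0 < y → y < ε → cnt p ((1/2:ℝ) * y) ≤ 2 ^ β * cnt p y ∧ 0 < cnt p y := by
    intro y hy hye
    obtain ⟨a, b⟩ := h (y := y) (by simpa [abs_of_pos hy] using hye) hy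
    rw [div_lt_iff₀ b] at a
    exact ⟨a.le, b⟩
  refine ⟨(H x hx0 hxe).2, fun s hs hs1 => ?_⟩
  have it : ∀ k : ℕ, cnt p ((1/2 : ℝ) ^ k * x) ≤ (2 ^ β) ^ k * cnt p x := by
    intro k
    induction k with
    | zero => simp
    | succ k ih =>
      have h1 : (1/2 : ℝ) ^ k ≤ 1 := pow_le_one₀ (by norm_num) (by norm_num)
      have := (H ((1/2 : ℝ) ^ k * x) (by positivity) (by nlinarith)).1
      rw [← mul_assoc, ← pow_succ'] at this
      refine this.trans ?_
      rw [pow_succ', mul_assoc]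
      gcongr
  obtain ⟨k, hk1, hk2⟩ := exists_nat_pow_near_of_lt_one hs hs1 (y := (1/2:ℝ))
    (by norm_num) (by norm_num)
  have h3 : cnt p (s * x) ≤ (2 ^ β) ^ (k+1) * cnt p x :=
    (cnt_anti hsum (by positivity) (by gcongr)).trans (it (k+1))
  refine h3.trans ?_
  gcongr
  · exact (H x hx0 hxe).2.le
  rw [pow_succ']
  gcongr
  have h4 : ((1/2:ℝ)^k) ^ (-β) ≤ s ^ (-β) :=
    Real.rpow_le_rpow_of_nonpos hs hk2 (by linarith)
  refine le_trans (le_of_eq ?_) h4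
  rw [← h2, ← Real.rpow_natCast, ← Real.rpow_natCast, ← Real.rpow_mul (by norm_num),
    ← Real.rpow_mul (by norm_num), mul_comm]

/-- Derivative of `t ^ r * exp (-t)`. -/
noncomputable def df (r : ℕ) (s : ℝ) : ℝ := r * s ^ (r-1) * Real.exp (-s) - s ^ r * Real.exp (-s)

lemma df_cont (r : ℕ) : Continuous (df r) := by unfold df; fun_prop

lemma df_int {r : ℕ} (hr : 1 ≤ r) {t : ℝ} :
    ∫ s in (0:ℝ)..t, df r s = t ^ r * Real.exp (-t) := by
  rw [intervalIntegral.integral_eq_sub_of_hasDerivAt (f := fun s => s ^ r * Real.exp (-s))]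
  · simp [show r ≠ 0 by omega]
  · intro x _
    have := (hasDerivAt_pow r x).mul ((hasDerivAt_neg x).exp)
    refine this.congr_deriv ?_
    unfold df; ring
  · exact (df_cont r).intervalIntegrable _ _

lemma layer {p : ℕ → ℝ} (hp : ∀ j, p j ∈ Set.Icc (0 : ℝ) 1) (hsum : Summable p)
    {r : ℕ} (hr : 1 ≤ r) {n : ℝ} (hn : 0 < n) :
    ∑' j, (n * p j) ^ r * Real.exp (-(n * p j)) =
      ∫ s in Set.Ioi (0:ℝ), df r s * cnt p (s * (1/n)) := by
  obtain ⟨C, hC⟩ := (isCompact_Icc (a := (0:ℝ)) (b := n)).exists_bound_of_continuousOn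
    (df_cont r).continuousOn
  have hC0 : 0 ≤ C := (norm_nonneg _).trans (hC 0 ⟨le_rfl, hn.le⟩)
  set F : ℕ → ℝ → ℝ := fun j => (Set.Ioc 0 (n * p j)).indicator (df r) with hF
  have hnp : ∀ j, 0 ≤ n * p j := fun j => mul_nonneg hn.le (hp j).1
  have hIoc : ∀ j, Set.Ioc 0 (n * p j) ⊆ Set.Ioi (0:ℝ) := fun j x hx => hx.1
  have hint : ∀ j, Integrable (F j) (volume.restrict (Set.Ioi (0:ℝ))) := by
    intro j
    have : IntegrableOn (df r) (Set.Ioc 0 (n * p j)) :=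
      ((df_cont r).integrableOn_Icc).mono_set Set.Ioc_subset_Icc_self
    exact (this.integrable_indicator measurableSet_Ioc).restrict
  have hval : ∀ j, ∫ s in Set.Ioi (0:ℝ), F j s = (n * p j) ^ r * Real.exp (-(n * p j)) := by
    intro j
    rw [← df_int hr, intervalIntegral.integral_of_le (hnp j), hF,
      setIntegral_indicator measurableSet_Ioc, Set.inter_eq_right.2 (hIoc j)]
  have hS : Summable fun j => ∫ s in Set.Ioi (0:ℝ), ‖F j s‖ := by
    refine Summable.of_nonneg_of_le (fun j => integral_nonneg fun _ => norm_nonneg _) (fun j => ?_)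
      (hsum.mul_left (C * n))
    have : (fun s => ‖F j s‖) = (Set.Ioc 0 (n * p j)).indicator (fun s => ‖df r s‖) := by
      funext s; exact norm_indicator_eq_indicator_norm _ _
    rw [this, setIntegral_indicator measurableSet_Ioc, Set.inter_eq_right.2 (hIoc j)]
    have h2 := norm_setIntegral_le_of_norm_le_const (μ := volume) (s := Set.Ioc 0 (n * p j))
      (f := fun s => ‖df r s‖) (C := C) (by simp) (fun s hs => by
        rw [norm_norm]
        exact hC s ⟨hs.1.le, hs.2.trans (by nlinarith [(hp j).2])⟩)
    refine (le_abs_self _).trans (h2.trans (le_of_eq ?_))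
    rw [Measure.real, Real.volume_Ioc, ENNReal.toReal_ofReal (by simpa using hnp j)]
    ring
  have := integral_tsum_of_summable_integral_norm hint hS
  simp_rw [hval] at this
  rw [this]
  refine setIntegral_congr_fun measurableSet_Ioi fun s hs => ?_
  have hs : 0 < s := hs
  have hfin := finite_set hsum (x := s * (1/n)) (by positivity)
  have hmem : ∀ j, j ∈ {j | s * (1/n) ≤ p j} ↔ s ∈ Set.Ioc 0 (n * p j) := by
    intro j
    simp only [Set.mem_ofPred_eq, Set.mem_Ioc, hs, true_and]
    rw [mul_one_div, div_le_iff₀ hn, mul_comm]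
  change ∑' j, F j s = _
  have hz : ∀ j ∉ hfin.toFinset, F j s = 0 := by
    intro j hj
    rw [Set.Finite.mem_toFinset, hmem] at hj
    exact Set.indicator_of_notMem hj _
  rw [tsum_eq_sum hz, Finset.sum_congr rfl (g := fun _ => df r s), Finset.sum_const, nsmul_eq_mul,
    mul_comm, cnt, Nat.card_eq_card_finite_toFinset hfin]
  intro j hj
  rw [Set.Finite.mem_toFinset, hmem] at hj
  exact Set.indicator_of_mem hj _

lemma gam_int {r : ℕ} (hr : 1 ≤ r) {β : ℝ} (hβ : β < 1) :
    IntegrableOn (fun s : ℝ => r * (Real.exp (-s) * s ^ ((r - β) - 1))) (Set.Ioi 0) ∧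
    IntegrableOn (fun s : ℝ => Real.exp (-s) * s ^ ((r + 1 - β) - 1)) (Set.Ioi 0) := by
  have : (1:ℝ) ≤ r := by exact_mod_cast hr
  exact ⟨(Real.GammaIntegral_convergent (by linarith)).const_mul _,
    Real.GammaIntegral_convergent (by linarith)⟩

lemma pw {r : ℕ} (hr : 1 ≤ r) (β : ℝ) {s : ℝ} (hs : 0 < s) :
    r * s ^ (r-1) * Real.exp (-s) * s ^ (-β) = r * (Real.exp (-s) * s ^ ((r - β) - 1)) ∧
    s ^ r * Real.exp (-s) * s ^ (-β) = Real.exp (-s) * s ^ ((r + 1 - β) - 1) := by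
  have e1 : (r:ℝ) - β - 1 = ((r-1 : ℕ) : ℝ) + -β := by push_cast [hr]; ring
  have e2 : (r:ℝ) + 1 - β - 1 = (r : ℝ) + -β := by ring
  rw [e1, e2, Real.rpow_add hs, Real.rpow_add hs, Real.rpow_natCast, Real.rpow_natCast]
  constructor <;> ring

lemma lim_int {r : ℕ} (hr : 1 ≤ r) {α : ℝ} (hα : α < 1) :
    ∫ s in Set.Ioi (0:ℝ), df r s * s ^ (-α) = α * Real.Gamma (r - α) := by
  have h1 : (1:ℝ) ≤ r := by exact_mod_cast hr
  obtain ⟨i1, i2⟩ := gam_int hr hα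
  have : ∫ s in Set.Ioi (0:ℝ), df r s * s ^ (-α) =
      ∫ s in Set.Ioi (0:ℝ), (r * (Real.exp (-s) * s ^ ((r - α) - 1)) -
        Real.exp (-s) * s ^ ((r + 1 - α) - 1)) := by
    refine setIntegral_congr_fun measurableSet_Ioi fun s hs => ?_
    have := pw hr α (s := s) hs
    simp only [df]
    rw [← this.1, ← this.2]; ring
  rw [this, integral_sub i1 i2, integral_const_mul, ← Real.Gamma_eq_integral (by linarith),
    ← Real.Gamma_eq_integral (by linarith), show (r:ℝ) + 1 - α = (r - α) + 1 by ring,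
    Real.Gamma_add_one (by linarith)]
  ring

lemma main_lim {p : ℕ → ℝ} (hp : ∀ j, p j ∈ Set.Icc (0 : ℝ) 1) (hsum : Summable p)
    {α : ℝ} (h0 : 0 < α) (h1 : α < 1)
    (hrat : ∀ c : ℝ, 0 < c →
      Tendsto (fun x => cnt p (c * x) / cnt p x) (𝓝[>] (0 : ℝ)) (𝓝 (c ^ (-α))))
    (hseq : Tendsto (fun n : ℕ => 1 / (n:ℝ)) atTop (𝓝[>] 0))
    {r : ℕ} (hr : 1 ≤ r) :
    Tendsto (fun n : ℕ => (∑' j, ((n:ℝ) * p j) ^ r * Real.exp (-((n:ℝ) * p j))) / cnt p (1/(n:ℝ)))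
      atTop (𝓝 (α * Real.Gamma (r - α))) := by
  obtain ⟨β, hβ0, hβ1⟩ := exists_between h1
  have hpot := hseq.eventually (potter hsum h0 hβ0 (hrat (1/2) (by norm_num)))
  rw [← lim_int hr h1]
  have key : Tendsto (fun n : ℕ => ∫ s in Set.Ioi (0:ℝ),
      df r s * (cnt p (s * (1/(n:ℝ))) / cnt p (1/(n:ℝ)))) atTop
      (𝓝 (∫ s in Set.Ioi (0:ℝ), df r s * s ^ (-α))) := by
    obtain ⟨i1, i2⟩ := gam_int hr hβ1
    obtain ⟨j1, j2⟩ := gam_int hr (β := 0) (by norm_num)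
    refine tendsto_integral_filter_of_dominated_convergence (fun s =>
      2 ^ β * (r * (Real.exp (-s) * s ^ ((r - β) - 1)) + Real.exp (-s) * s ^ ((r + 1 - β) - 1))
      + (r * (Real.exp (-s) * s ^ (((r:ℝ) - 0) - 1)) + Real.exp (-s) * s ^ (((r:ℝ) + 1 - 0) - 1)))
      ?_ ?_ (((i1.add i2).const_mul _).add (j1.add j2)) ?_
    · filter_upwards [eventually_gt_atTop 0] with n hn
      have hn' : (0:ℝ) < n := by exact_mod_cast hn
      refine (df_cont r).aestronglyMeasurable.mul (AEMeasurable.aestronglyMeasurable ?_)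
      refine aemeasurable_restrict_of_antitoneOn measurableSet_Ioi fun a ha b hb hab => ?_
      have ha : 0 < a := ha
      refine div_le_div_of_nonneg_right ?_ (cnt_nonneg _ _)
      exact cnt_anti hsum (by positivity) (by gcongr)
    · filter_upwards [hpot, eventually_gt_atTop 0] with n hn hn0
      have hn' : (0:ℝ) < n := by exact_mod_cast hn0
      filter_upwards [ae_restrict_mem measurableSet_Ioi] with s hs
      have hs : 0 < s := hs
      rw [← (pw hr β hs).1, ← (pw hr β hs).2, ← (pw hr 0 hs).1, ← (pw hr 0 hs).2, neg_zero,
        Real.rpow_zero, mul_one, mul_one, norm_mul,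
        Real.norm_of_nonneg (div_nonneg (cnt_nonneg _ _) (cnt_nonneg _ _))]
      have hd : ‖df r s‖ ≤ r * s ^ (r-1) * Real.exp (-s) + s ^ r * Real.exp (-s) := by
        refine (norm_sub_le _ _).trans (le_of_eq ?_)
        rw [Real.norm_of_nonneg (by positivity), Real.norm_of_nonneg (by positivity)]
      have hq : cnt p (s * (1/(n:ℝ))) / cnt p (1/(n:ℝ)) ≤ 2 ^ β * s ^ (-β) + 1 := by
        rw [div_le_iff₀ hn.1]
        have hpos : 0 ≤ 2 ^ β * s ^ (-β) * cnt p (1/(n:ℝ)) := by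
          have := hn.1; positivity
        rcases le_total s 1 with h | h
        · have := hn.2 s hs h
          linarith [hn.1]
        · have := cnt_anti hsum (x := 1/(n:ℝ)) (y := s * (1/(n:ℝ))) (by positivity)
            (le_mul_of_one_le_left (by positivity) h)
          linarith
      refine (mul_le_mul hd hq (div_nonneg (cnt_nonneg _ _) (cnt_nonneg _ _))
        (by positivity)).trans (le_of_eq ?_)
      ring
    · filter_upwards [ae_restrict_mem measurableSet_Ioi] with s hs
      exact ((hrat s hs).comp hseq).const_mul _
  refine key.congr' ?_
  filter_upwards [eventually_gt_atTop 0] with n hn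
  rw [layer hp hsum hr (by exact_mod_cast hn), ← integral_div]
  simp_rw [mul_div_assoc]

end PhiAux

/-- If `(p_j)` is regularly varying with index `α ∈ (0,1)`, then for every
`r ≥ 1`, `Φ_{n,r} = Σ_j (n p_j)^r e^{-n p_j}/r!` satisfies
`Φ_{n,r} ≃ (α Γ(r-α)/r!) n^α ℓ(n)` as `n → ∞`; in particular `Φ_{n,r} → ∞`. -/
theorem Phi_nr_regular_variation_asymptotics
    (p : ℕ → ℝ) (hp : ∀ j, p j ∈ Set.Icc (0 : ℝ) 1) (hsum : Summable p)
    (α : ℝ) (hα : α ∈ Set.Ioo (0 : ℝ) 1)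
    (L : ℝ → ℝ)
    (hL : ∀ c : ℝ, 0 < c → Tendsto (fun t : ℝ => L (c * t) / L t) atTop (𝓝 1))
    (hreg : Tendsto (fun x : ℝ => (Nat.card {j | x ≤ p j} : ℝ) / (x ^ (-α) * L (1 / x)))
      (𝓝[>] (0 : ℝ)) (𝓝 1)) :
    ∀ r : ℕ, 1 ≤ r →
      Tendsto (fun n : ℕ =>
          (∑' j, ((n : ℝ) * p j) ^ r * Real.exp (-((n : ℝ) * p j)) / (Nat.factorial r)) /
            (α * Real.Gamma ((r : ℝ) - α) / (Nat.factorial r) * (n : ℝ) ^ α * L n))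
        atTop (𝓝 1) ∧
      Tendsto (fun n : ℕ =>
          ∑' j, ((n : ℝ) * p j) ^ r * Real.exp (-((n : ℝ) * p j)) / (Nat.factorial r))
        atTop atTop := by
  intro r hr
  have hreg' : Tendsto (fun x : ℝ => PhiAux.cnt p x / (x ^ (-α) * L (1 / x)))
      (𝓝[>] (0 : ℝ)) (𝓝 1) := hreg
  have hrat := fun (c : ℝ) (hc : 0 < c) => PhiAux.cnt_ratio hL hreg' hc
  have hseq : Tendsto (fun n : ℕ => 1 / (n:ℝ)) atTop (𝓝[>] 0) := by
    simp_rw [one_div]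
    exact tendsto_inv_atTop_nhdsGT_zero.comp tendsto_natCast_atTop_atTop
  have hm := PhiAux.main_lim hp hsum hα.1 hα.2 hrat hseq hr
  have hinf := (PhiAux.cnt_tendsto hsum hα.1 (hrat (1/2) (by norm_num))).comp hseq
  have h1 : (1:ℝ) ≤ r := by exact_mod_cast hr
  have hG : 0 < α * Real.Gamma (r - α) :=
    mul_pos hα.1 (Real.Gamma_pos_of_pos (by linarith [hα.2]))
  have hf : (0:ℝ) < (Nat.factorial r : ℝ) := by exact_mod_cast Nat.factorial_pos r
  simp_rw [tsum_div_const]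
  constructor
  · have h3 := (hm.div_const (α * Real.Gamma (r - α))).mul (hreg'.comp hseq)
    rw [div_self hG.ne', one_mul] at h3
    refine h3.congr' ?_
    filter_upwards [eventually_gt_atTop 0, hinf.eventually (eventually_gt_atTop 0)] with n hn hc
    have hn' : (0:ℝ) < n := by exact_mod_cast hn
    simp only [Function.comp] at hc ⊢
    have e : (1 / (n:ℝ)) ^ (-α) = (n:ℝ) ^ α := by
      rw [one_div, Real.inv_rpow hn'.le, Real.rpow_neg hn'.le, inv_inv]
    rw [e, one_div_one_div]
    generalize (∑' j, ((n:ℝ) * p j) ^ r * Real.exp (-((n:ℝ) * p j))) = S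
    have hc' := hc.ne'
    generalize PhiAux.cnt p (1 / (n:ℝ)) = c at hc'
    rw [div_div, div_mul_div_comm, div_div, show (Nat.factorial r : ℝ) *
      (α * Real.Gamma (r - α) / (Nat.factorial r) * (n:ℝ) ^ α * L n) =
      α * Real.Gamma (r - α) * ((n:ℝ) ^ α * L n) by field_simp,
      show c * (α * Real.Gamma (r - α)) * ((n:ℝ) ^ α * L n) =
      (α * Real.Gamma (r - α) * ((n:ℝ) ^ α * L n)) * c by ring, mul_div_mul_right _ _ hc']
  · refine Tendsto.atTop_div_const hf ?_
    refine (hm.pos_mul_atTop hG hinf).congr' ?_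
    filter_upwards [hinf.eventually (eventually_gt_atTop 0)] with n hc
    exact div_mul_cancel₀ _ hc.ne'
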